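/- Let A = {mean, sum} or A = {mean, max}. There is a constant C (independent of the formula) such that for every PML formula φ of modal depth at most 1 (φ ∈ PML₁, with arbitrary modalities id, E_in, E_out, ⊤), there exist an MPNN M_φ ∈ M_A with at most C·(deg(φ)+1) layers and a natural number e ≤ C·(deg(φ)+1) such that M_φ recognises φ over the class of all pointed graphs (G,v) whose focus v is strongly marked by colour p, with certainty c(|V|) = 1/|V|^e. -/

import Mathlib

namespace PMLMPNN

/-- Modalities of Peano modal logic. -/
inductive Modality where
  | id | ein | eout | top
deriving DecidableEq

/-- A normalised integer inequality `∑ i, a i * ∏ (mon i) ≤ b`. -/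
structure PeanoIneq (m : ℕ) where
  K : ℕ
  a : Fin K → ℤ
  mon : Fin K → List (Fin m)
  b : ℤ

/-- Value of a monomial (a list of variables) under an assignment. -/
def monValZ {m : ℕ} (c : Fin m → ℕ) (l : List (Fin m)) : ℤ :=
  (l.map (fun j => (c j : ℤ))).prod

def PeanoIneq.sat {m : ℕ} (t : PeanoIneq m) (c : Fin m → ℕ) : Bool :=
  decide ((∑ i, t.a i * monValZ c (t.mon i)) ≤ t.b)

def PeanoIneq.deg {m : ℕ} (t : PeanoIneq m) : ℕ :=
  Finset.univ.sup (fun i => (t.mon i).length)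

/-- Peano formulas: Boolean combinations of normalised inequalities. -/
inductive PeanoFormula (m : ℕ) where
  | ineq : PeanoIneq m → PeanoFormula m
  | not : PeanoFormula m → PeanoFormula m
  | and : PeanoFormula m → PeanoFormula m → PeanoFormula m

def PeanoFormula.sat {m : ℕ} (c : Fin m → ℕ) : PeanoFormula m → Bool
  | .ineq t => t.sat c
  | .not ψ => ! ψ.sat c
  | .and ψ₁ ψ₂ => ψ₁.sat c && ψ₂.sat c

def PeanoFormula.deg {m : ℕ} : PeanoFormula m → ℕ
  | .ineq t => t.deg
  | .not ψ => ψ.deg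
  | .and ψ₁ ψ₂ => max ψ₁.deg ψ₂.deg

/-- A term is homogeneous if it has no constant part and all its monomials
have the same degree. -/
def PeanoIneq.Homog {m : ℕ} (t : PeanoIneq m) : Prop :=
  t.b = 0 ∧ ∀ i, (t.mon i).length = t.deg

def PeanoFormula.Homog {m : ℕ} : PeanoFormula m → Prop
  | .ineq t => t.Homog
  | .not ψ => ψ.Homog
  | .and ψ₁ ψ₂ => ψ₁.Homog ∧ ψ₂.Homog

/-- The set of monomials occurring in a Peano formula. -/
def PeanoFormula.mons {m : ℕ} : PeanoFormula m → Finset (List (Fin m))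
  | .ineq t => Finset.univ.image t.mon
  | .not ψ => ψ.mons
  | .and ψ₁ ψ₂ => ψ₁.mons ∪ ψ₂.mons

/-- The set of constants occurring in a Peano formula. -/
def PeanoFormula.consts {m : ℕ} : PeanoFormula m → Finset ℤ
  | .ineq t => {t.b}
  | .not ψ => ψ.consts
  | .and ψ₁ ψ₂ => ψ₁.consts ∪ ψ₂.consts

/-- PML formulas over `k` colours (propositions). -/
inductive PML (k : ℕ) where
  | prop : Fin k → PML k
  | not : PML k → PML k
  | and : PML k → PML k → PML k
  | modal : (m : ℕ) → (Fin m → Modality) → PeanoFormula m → (Fin m → PML k) → PML k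

def PML.md {k : ℕ} : PML k → ℕ
  | .prop _ => 0
  | .not φ => φ.md
  | .and φ₁ φ₂ => max φ₁.md φ₂.md
  | .modal _ _ _ φs => 1 + Finset.univ.sup (fun i => (φs i).md)

def PML.deg {k : ℕ} : PML k → ℕ
  | .prop _ => 0
  | .not φ => φ.deg
  | .and φ₁ φ₂ => max φ₁.deg φ₂.deg
  | .modal _ _ ψ φs => max ψ.deg (Finset.univ.sup (fun i => (φs i).deg))

def PML.onlyTop {k : ℕ} : PML k → Prop
  | .prop _ => True
  | .not φ => φ.onlyTop
  | .and φ₁ φ₂ => φ₁.onlyTop ∧ φ₂.onlyTop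
  | .modal _ π _ φs => (∀ i, π i = Modality.top) ∧ (∀ i, (φs i).onlyTop)

def PML.onlyE {k : ℕ} : PML k → Prop
  | .prop _ => True
  | .not φ => φ.onlyE
  | .and φ₁ φ₂ => φ₁.onlyE ∧ φ₂.onlyE
  | .modal _ π _ φs => (∀ i, π i = Modality.ein ∨ π i = Modality.eout) ∧ (∀ i, (φs i).onlyE)

/-- Propositional formulas: no modal subformula at all. -/
def PML.NoModal {k : ℕ} : PML k → Prop
  | .prop _ => True
  | .not φ => φ.NoModal
  | .and φ₁ φ₂ => φ₁.NoModal ∧ φ₂.NoModal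
  | .modal _ _ _ _ => False

/-- Subformula relation. -/
inductive PML.Sub {k : ℕ} : PML k → PML k → Prop where
  | refl (φ : PML k) : PML.Sub φ φ
  | not {χ φ : PML k} : PML.Sub χ φ → PML.Sub χ (.not φ)
  | and_left {χ φ₁ φ₂ : PML k} : PML.Sub χ φ₁ → PML.Sub χ (.and φ₁ φ₂)
  | and_right {χ φ₁ φ₂ : PML k} : PML.Sub χ φ₂ → PML.Sub χ (.and φ₁ φ₂)
  | modal {χ : PML k} {m : ℕ} {π : Fin m → Modality} {ψ : PeanoFormula m}
      {φs : Fin m → PML k} (i : Fin m) :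
      PML.Sub χ (φs i) → PML.Sub χ (.modal m π ψ φs)

/-- Finite directed node-labelled graphs with `k` colours; labels in `{0,1}^k`
are represented by Boolean vectors. -/
structure Graph (k : ℕ) where
  n : ℕ
  E : Finset (Fin n × Fin n)
  L : Fin n → Fin k → Bool

def Graph.neighIn {k : ℕ} (G : Graph k) (v : Fin G.n) : Finset (Fin G.n) :=
  Finset.univ.filter (fun u => (u, v) ∈ G.E)

def Graph.neighOut {k : ℕ} (G : Graph k) (v : Fin G.n) : Finset (Fin G.n) :=
  Finset.univ.filter (fun u => (v, u) ∈ G.E)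

def Graph.Regular {k : ℕ} (G : Graph k) : Prop :=
  ∀ u v : Fin G.n,
    (G.neighIn u).card = (G.neighIn v).card ∧ (G.neighOut u).card = (G.neighOut v).card

/-- `v` is marked by colour `p`. -/
def Graph.MarkedBy {k : ℕ} (G : Graph k) (v : Fin G.n) (p : Fin k) : Prop :=
  ∀ u : Fin G.n, G.L u p = true ↔ u = v

/-- `v` is strongly marked by colour `p`: marked and `v ∈ neigh(v)`. -/
def Graph.StronglyMarkedBy {k : ℕ} (G : Graph k) (v : Fin G.n) (p : Fin k) : Prop :=
  G.MarkedBy v p ∧ (v, v) ∈ G.E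

def Graph.modSem {k : ℕ} (G : Graph k) (v : Fin G.n) : Modality → Finset (Fin G.n)
  | .id => {v}
  | .ein => G.neighIn v
  | .eout => G.neighOut v
  | .top => Finset.univ

/-- Satisfaction of PML formulas on pointed graphs. -/
def PML.sat {k : ℕ} (G : Graph k) : PML k → Fin G.n → Bool
  | .prop i, v => G.L v i
  | .not φ, v => ! PML.sat G φ v
  | .and φ₁ φ₂, v => PML.sat G φ₁ v && PML.sat G φ₂ v
  | .modal _ π ψ φs, v =>
      ψ.sat (fun i => ((G.modSem v (π i)).filter (fun u => PML.sat G (φs i) u = true)).card)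

/-- Feedforward neural networks with ReLU activations and rational weights. -/
inductive FNN : ℕ → ℕ → Type where
  | layer {din dout : ℕ} (w : Fin dout → Fin din → ℚ) (b : Fin dout → ℚ) : FNN din dout
  | comp {d₁ d₂ d₃ : ℕ} : FNN d₁ d₂ → FNN d₂ d₃ → FNN d₁ d₃

def FNN.eval : {din dout : ℕ} → FNN din dout → (Fin din → ℚ) → Fin dout → ℚ
  | _, _, .layer w b, x => fun j => max 0 (b j + ∑ i, w j i * x i)
  | _, _, .comp f g, x => g.eval (f.eval x)

/-- Aggregation functions on finite multisets of vectors. -/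
inductive Agg where
  | mean | sum | max
deriving DecidableEq

noncomputable def Agg.eval {d : ℕ} : Agg → Multiset (Fin d → ℚ) → Fin d → ℚ
  | .mean, s => fun i => (s.map (fun f => f i)).sum / (Multiset.card s : ℚ)
  | .sum, s => fun i => (s.map (fun f => f i)).sum
  | .max, s => fun i => ((s.map (fun f => f i)).toList).foldr Max.max 0

/-- One MPNN layer: a combination function (an FNN applied to the previous
state and the three aggregated messages) together with the choice of the two
local and the global aggregation functions. -/
structure MPNNLayer (din dout : ℕ) where
  comb : FNN (din + din + din + din) dout
  locIn : Agg
  locOut : Agg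
  glob : Agg

noncomputable def MPNNLayer.step {k din dout : ℕ} (l : MPNNLayer din dout) (G : Graph k)
    (x : Fin G.n → Fin din → ℚ) : Fin G.n → Fin dout → ℚ :=
  fun v => l.comb.eval
    (Fin.append (Fin.append (Fin.append (x v)
      (l.locIn.eval ((G.neighIn v).val.map x)))
      (l.locOut.eval ((G.neighOut v).val.map x)))
      (l.glob.eval ((Finset.univ : Finset (Fin G.n)).val.map x)))

/-- A message passing neural network: `L` layers with state dimensions
`dims 0, dims 1, …, dims L`. -/
structure MPNN where
  L : ℕ
  dims : ℕ → ℕ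
  layers : (i : ℕ) → MPNNLayer (dims i) (dims (i + 1))

/-- Initial state: the label of the node (padded with zeros if needed). -/
def Graph.init {k : ℕ} (G : Graph k) (d : ℕ) (v : Fin G.n) : Fin d → ℚ :=
  fun j => if h : (j : ℕ) < k then (if G.L v ⟨j, h⟩ then 1 else 0) else 0

/-- The state `x_v^{(i)}` computed by `M` on `G`. -/
noncomputable def MPNN.state {k : ℕ} (M : MPNN) (G : Graph k) : (i : ℕ) → Fin G.n → Fin (M.dims i) → ℚ
  | 0 => fun v => G.init (M.dims 0) v
  | i + 1 => (M.layers i).step G (M.state G i)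

/-- Last coordinate of a vector. -/
def lastVal {d : ℕ} (x : Fin d → ℚ) : ℚ :=
  if h : 0 < d then x ⟨d - 1, Nat.sub_lt h Nat.one_pos⟩ else 0

/-- The output `M(G,v)_⊥`: the last coordinate of the final state. -/
noncomputable def MPNN.out {k : ℕ} (M : MPNN) (G : Graph k) (v : Fin G.n) : ℚ :=
  lastVal (M.state G M.L v)

/-- All aggregations of `M` belong to the set `A`. -/
def MPNN.UsesAggs (M : MPNN) (A : Set Agg) : Prop :=
  ∀ i < M.L, (M.layers i).locIn ∈ A ∧ (M.layers i).locOut ∈ A ∧ (M.layers i).glob ∈ A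

/-- `M` belongs to the class `M_mean`. -/
def MPNN.IsMean (M : MPNN) : Prop := M.UsesAggs {Agg.mean}

/-- `M` recognises `φ` over the class `Cls` with certainty `c(|V|)`. -/
def Recognises {k : ℕ} (M : MPNN) (φ : PML k)
    (Cls : (G : Graph k) → Fin G.n → Prop) (c : ℕ → ℚ) : Prop :=
  ∀ (G : Graph k) (v : Fin G.n), Cls G v →
    (PML.sat G φ v = true → M.out G v = c G.n) ∧
    (PML.sat G φ v = false → M.out G v = 0)

end PMLMPNN
namespace PMLMPNN

/-! ### Feedforward networks: closure properties -/

lemma FNN.eval_nonneg {n m : ℕ} (N : FNN n m) : ∀ (x : Fin n → ℚ) (j : Fin m), 0 ≤ N.eval x j := by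
  induction N with
  | layer w b => intro x j; simp [FNN.eval]
  | comp f g _ ihg => intro x j; exact ihg _ j

lemma FNN.exists_select {n m : ℕ} (r : Fin m → Fin n) :
    ∃ N : FNN n m, ∀ x : Fin n → ℚ, (∀ i, 0 ≤ x i) → N.eval x = fun j => x (r j) := by
  refine ⟨.layer (fun j i => if i = r j then 1 else 0) 0, fun x hx => ?_⟩
  funext j
  simp [FNN.eval, hx]

lemma FNN.exists_par {n m : ℕ} (N : FNN n m) (q : ℕ) :
    ∃ N' : FNN (n + q) (m + q), ∀ (x : Fin n → ℚ) (y : Fin q → ℚ), (∀ j, 0 ≤ y j) →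
      N'.eval (Fin.append x y) = Fin.append (N.eval x) y := by
  induction N with
  | layer w b =>
    refine ⟨.layer (Fin.append (fun j => Fin.append (w j) (fun _ => 0))
      (fun j => Fin.append (fun _ => 0) (fun i => if i = j then 1 else 0)))
      (Fin.append b (fun _ => 0)), fun x y hy => ?_⟩
    funext j
    refine Fin.addCases (fun j => ?_) (fun j => ?_) j
    · simp [FNN.eval, Fin.sum_univ_add]
    · simp [FNN.eval, Fin.sum_univ_add, hy]
  | comp f g ihf ihg =>
    obtain ⟨f', hf⟩ := ihf
    obtain ⟨g', hg⟩ := ihg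
    refine ⟨.comp f' g', fun x y hy => ?_⟩
    simp only [FNN.eval]
    rw [hf x y hy, hg _ y hy]

/-- A scalar function computed (on nonnegative inputs) by some FNN. -/
def Sc {n : ℕ} (f : (Fin n → ℚ) → ℚ) : Prop :=
  ∃ N : FNN n 1, ∀ x : Fin n → ℚ, (∀ i, 0 ≤ x i) → N.eval x 0 = f x

lemma Sc.family_aux {n : ℕ} : ∀ (k : ℕ) (g : Fin k → (Fin n → ℚ) → ℚ), (∀ j, Sc (g j)) →
    ∃ N : FNN n (k + n), ∀ x : Fin n → ℚ, (∀ i, 0 ≤ x i) →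
      N.eval x = Fin.append (fun j => g j x) x := by
  intro k
  induction k with
  | zero =>
    intro g _
    obtain ⟨N, hN⟩ := FNN.exists_select (n := n) (m := 0 + n)
      (Fin.addCases (fun j => j.elim0) (fun i => i))
    refine ⟨N, fun x hx => ?_⟩
    rw [hN x hx]
    funext j
    refine Fin.addCases (fun j => j.elim0) (fun j => ?_) j
    rw [Fin.append_right, Fin.addCases_right]
  | succ k ih =>
    intro g hg
    obtain ⟨N, hN⟩ := ih (fun j => g j.castSucc) (fun j => hg _)
    obtain ⟨N1, hN1⟩ := hg (Fin.last k)
    obtain ⟨S, hS⟩ := FNN.exists_select (n := k + n) (m := n + (k + n))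
      (Fin.addCases (fun i => Fin.natAdd k i) (fun i => i))
    obtain ⟨P, hP⟩ := N1.exists_par (k + n)
    obtain ⟨R, hR⟩ := FNN.exists_select (n := 1 + (k + n)) (m := k + 1 + n)
      (Fin.addCases (Fin.lastCases (Fin.castAdd _ 0) (fun j => Fin.natAdd 1 (Fin.castAdd n j)))
        (fun i => Fin.natAdd 1 (Fin.natAdd k i)))
    refine ⟨.comp (.comp (.comp N S) P) R, fun x hx => ?_⟩
    simp only [FNN.eval]
    rw [hS _ (FNN.eval_nonneg N x)]
    have h1 : (fun j => N.eval x ((Fin.addCases (fun i => Fin.natAdd k i) (fun i => i) :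
        Fin (n + (k + n)) → Fin (k + n)) j)) = Fin.append x (N.eval x) := by
      funext j
      refine Fin.addCases (fun j => ?_) (fun j => ?_) j
      · simp [hN x hx]
      · simp
    rw [h1, hP _ _ (FNN.eval_nonneg N x), hR]
    · funext j
      refine Fin.addCases (fun j => ?_) (fun j => ?_) j
      · refine Fin.lastCases ?_ (fun j => ?_) j
        · simp [hN1 x hx]
        · simp [hN x hx]
      · simp [hN x hx]
    · intro i
      refine Fin.addCases (fun j => ?_) (fun j => ?_) i
      · simpa using FNN.eval_nonneg N1 x j
      · simpa using FNN.eval_nonneg N x j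

lemma Sc.family {n k : ℕ} (g : Fin k → (Fin n → ℚ) → ℚ) (hg : ∀ j, Sc (g j)) :
    ∃ N : FNN n k, ∀ x : Fin n → ℚ, (∀ i, 0 ≤ x i) → ∀ j, N.eval x j = g j x := by
  obtain ⟨N, hN⟩ := Sc.family_aux k g hg
  obtain ⟨S, hS⟩ := FNN.exists_select (n := k + n) (m := k) (Fin.castAdd n)
  refine ⟨.comp N S, fun x hx j => ?_⟩
  simp only [FNN.eval]
  rw [hS _ (FNN.eval_nonneg N x), hN x hx]
  simp

lemma Sc.var {n : ℕ} (i : Fin n) : Sc (fun x => x i) := by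
  obtain ⟨S, hS⟩ := FNN.exists_select (n := n) (m := 1) (fun _ => i)
  exact ⟨S, fun x hx => by rw [hS x hx]⟩

lemma Sc.relu {n : ℕ} {κ : Type*} [Fintype κ] (w : κ → ℚ) (b : ℚ) {g : κ → (Fin n → ℚ) → ℚ}
    (hg : ∀ j, Sc (g j)) : Sc (fun x => max 0 (b + ∑ j, w j * g j x)) := by
  let e := Fintype.equivFin κ
  obtain ⟨N, hN⟩ := Sc.family (fun j => g (e.symm j)) (fun j => hg _)
  refine ⟨.comp N (.layer (fun _ j => w (e.symm j)) (fun _ => b)), fun x hx => ?_⟩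
  simp only [FNN.eval]
  congr 2
  rw [← Equiv.sum_comp e]
  simp [hN x hx]

lemma Sc.relu2 {n : ℕ} (b α β : ℚ) {f g : (Fin n → ℚ) → ℚ} (hf : Sc f) (hg : Sc g) :
    Sc (fun x => max 0 (b + α * f x + β * g x)) := by
  have := Sc.relu (n := n) (κ := Fin 2) ![α, β] b (g := ![f, g])
    (by intro j; fin_cases j <;> simpa)
  simpa [Fin.sum_univ_two, add_assoc] using this

lemma Sc.relu3 {n : ℕ} (b α β γ : ℚ) {f g h : (Fin n → ℚ) → ℚ} (hf : Sc f) (hg : Sc g)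
    (hh : Sc h) : Sc (fun x => max 0 (b + α * f x + β * g x + γ * h x)) := by
  have := Sc.relu (n := n) (κ := Fin 3) ![α, β, γ] b (g := ![f, g, h])
    (by intro j; fin_cases j <;> simpa)
  simpa [Fin.sum_univ_three, add_assoc] using this

/-- Every Boolean function of `0/1` inputs is computed by an FNN. -/
lemma Sc.bool {n : ℕ} {κ : Type} [Fintype κ] [DecidableEq κ] (r : κ → Fin n)
    (χ : (κ → Bool) → Bool) :
    ∃ g : (Fin n → ℚ) → ℚ, Sc g ∧ ∀ (x : Fin n → ℚ) (a : κ → Bool),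
      (∀ i, x (r i) = if a i then 1 else 0) → g x = if χ a then 1 else 0 := by
  have h1 : ∀ a : κ → Bool, Sc (n := n) (fun x => max 0
      ((1 - ∑ i, if a i then (1 : ℚ) else 0) + ∑ i, (if a i then (1 : ℚ) else -1) * x (r i))) :=
    fun a => Sc.relu _ _ (fun i => Sc.var (r i))
  refine ⟨_, Sc.relu (fun a : κ → Bool => if χ a then (1 : ℚ) else 0) 0 h1, fun x a hx => ?_⟩
  have h2 : ∀ c : κ → Bool, max 0
      ((1 - ∑ i, if c i then (1 : ℚ) else 0) + ∑ i, (if c i then (1 : ℚ) else -1) * x (r i))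
      = if c = a then 1 else 0 := by
    intro c
    have h3 : (1 - ∑ i, if c i then (1 : ℚ) else 0) + ∑ i, (if c i then (1 : ℚ) else -1) * x (r i)
        = 1 - ∑ i, (if c i = a i then (0 : ℚ) else 1) := by
      rw [sub_add, ← Finset.sum_sub_distrib]
      congr 1
      refine Finset.sum_congr rfl fun i _ => ?_
      rw [hx]
      cases c i <;> cases a i <;> simp
    rw [h3]
    split_ifs with hc
    · subst hc; simp
    · obtain ⟨i, hi⟩ := Function.ne_iff.mp hc
      apply max_eq_left
      have := Finset.single_le_sum (f := fun i => if c i = a i then (0 : ℚ) else 1)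
        (fun i _ => by positivity) (Finset.mem_univ i)
      simp only [hi, if_false] at this
      linarith
  simp only [h2]
  simp
  split_ifs <;> simp

/-! ### Extended labels and counts -/

/-- Extended labels: colours, membership in the in- and out-neighbourhood of the focus. -/
abbrev XL (k : ℕ) : Type := Fin k ⊕ Bool → Bool

/-- Properties of extended labels. -/
abbrev XP (k : ℕ) : Type := XL k → Bool

def Graph.ext {k : ℕ} (G : Graph k) (v u : Fin G.n) : XL k
  | .inl i => G.L u i
  | .inr false => decide ((u, v) ∈ G.E)
  | .inr true => decide ((v, u) ∈ G.E)

def Graph.cnt {k : ℕ} (G : Graph k) (v : Fin G.n) (χ : XP k) : ℕ :=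
  (Finset.univ.filter (fun u => χ (G.ext v u) = true)).card

def markP {k : ℕ} (p : Fin k) : XP k := fun a => a (.inl p)

def PML.pev {k : ℕ} : PML k → (Fin k → Bool) → Bool
  | .prop i, a => a i
  | .not φ, a => ! φ.pev a
  | .and φ₁ φ₂, a => φ₁.pev a && φ₂.pev a
  | .modal _ _ _ _, _ => false

lemma PML.sat_eq_pev {k : ℕ} (G : Graph k) (u : Fin G.n) (φ : PML k) (h : φ.md = 0) :
    PML.sat G φ u = φ.pev (G.L u) := by
  induction φ with
  | prop i => rfl
  | not φ ih => simp only [PML.sat, PML.pev, ih h]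
  | and φ₁ φ₂ ih₁ ih₂ =>
    simp only [PML.md] at h
    simp only [PML.sat, PML.pev, ih₁ (by omega), ih₂ (by omega)]
  | modal m π ψ φs ih => simp [PML.md] at h

def modP {k : ℕ} (p : Fin k) : Modality → XP k
  | .id => fun a => a (.inl p)
  | .ein => fun a => a (.inr false)
  | .eout => fun a => a (.inr true)
  | .top => fun _ => true

def argP {k : ℕ} (p : Fin k) (π : Modality) (φ : PML k) : XP k :=
  fun a => modP p π a && φ.pev (fun i => a (.inl i))

lemma mem_modSem {k : ℕ} {G : Graph k} {v : Fin G.n} {p : Fin k} (hv : G.MarkedBy v p)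
    (π : Modality) (u : Fin G.n) : u ∈ G.modSem v π ↔ modP p π (G.ext v u) = true := by
  cases π
  · simp [Graph.modSem, modP, Graph.ext, hv u]
  · simp [Graph.modSem, modP, Graph.ext, Graph.neighIn]
  · simp [Graph.modSem, modP, Graph.ext, Graph.neighOut]
  · simp [Graph.modSem, modP]

lemma card_arg {k : ℕ} {G : Graph k} {v : Fin G.n} {p : Fin k} (hv : G.MarkedBy v p)
    (π : Modality) (φ : PML k) (hφ : φ.md = 0) :
    ((G.modSem v π).filter (fun u => PML.sat G φ u = true)).card = G.cnt v (argP p π φ) := by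
  unfold Graph.cnt
  congr 1
  ext u
  simp only [Finset.mem_filter, mem_modSem hv, PML.sat_eq_pev G u φ hφ, argP, Finset.mem_univ,
    true_and, Bool.and_eq_true]
  rfl

lemma cnt_mark {k : ℕ} {G : Graph k} {v : Fin G.n} {p : Fin k} (hv : G.MarkedBy v p) :
    G.cnt v (markP p) = 1 := by
  unfold Graph.cnt
  rw [Finset.card_eq_one]
  refine ⟨v, ?_⟩
  ext u
  rw [Finset.mem_filter, Finset.mem_singleton, ← hv u]
  simp [markP, Graph.ext]

lemma cnt_prop {k : ℕ} {G : Graph k} {v : Fin G.n} {p : Fin k} (hv : G.MarkedBy v p) (i : Fin k) :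
    G.cnt v (fun a => a (.inl p) && a (.inl i)) = if G.L v i then 1 else 0 := by
  unfold Graph.cnt
  have : (Finset.univ.filter (fun u => (G.ext v u (.inl p) && G.ext v u (.inl i)) = true))
      = if G.L v i then {v} else ∅ := by
    ext u
    simp only [Graph.ext, Bool.and_eq_true, hv u, Finset.mem_filter, Finset.mem_univ, true_and]
    split_ifs with h
    · simp only [Finset.mem_singleton]
      exact ⟨fun h => h.1, fun h' => ⟨h', h' ▸ h⟩⟩
    · simp only [Finset.notMem_empty, iff_false]
      rintro ⟨rfl, h'⟩; exact h h'
  rw [this]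
  split_ifs <;> simp

/-! ### The final Boolean combination -/

def padL {ι : Type} (D : ℕ) (M : ι) (l : List ι) : Fin D → ι := fun j => l.getD j M

lemma prod_padL {ι : Type} (F : ι → ℚ) (M : ι) (hM : F M = 1) : ∀ (D : ℕ) (l : List ι),
    l.length ≤ D → ∏ i, F (padL D M l i) = (l.map F).prod := by
  intro D
  induction D with
  | zero => intro l hl; simp at hl; simp [hl]
  | succ D ih =>
    intro l hl
    rw [Fin.prod_univ_succ]
    cases l with
    | nil => simp [padL, hM]
    | cons a l =>
      have := ih l (by simpa using hl)
      simp only [padL] at this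
      rw [List.map_cons, List.prod_cons, ← this]
      rfl

/-- The coordinates `r s` of `x` hold the normalised monomials. -/
def Good {ι : Type} {D n : ℕ} (M : ι) (r : (Fin D → ι) → Fin n) (c : ι → ℕ) (N : ℕ)
    (x : Fin n → ℚ) : Prop :=
  0 < N ∧ c M = 1 ∧ ∀ s, x (r s) = (∏ i, (c (s i) : ℚ)) / (N : ℚ) ^ D

lemma Good.pad {ι : Type} {D n : ℕ} {M : ι} {r : (Fin D → ι) → Fin n} {c : ι → ℕ} {N : ℕ}
    {x : Fin n → ℚ} (h : Good M r c N x) (l : List ι) (hl : l.length ≤ D) :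
    x (r (padL D M l)) = (l.map (fun i => (c i : ℚ))).prod / (N : ℚ) ^ D := by
  rw [h.2.2, prod_padL (fun i => (c i : ℚ)) M (by simp [h.2.1]) D l hl]

/-- `φ`-like Boolean property computed with certainty `1 / N ^ D`. -/
def Cert {ι : Type} {D n : ℕ} (M : ι) (r : (Fin D → ι) → Fin n) (P : (ι → ℕ) → Bool) : Prop :=
  ∃ g : (Fin n → ℚ) → ℚ, Sc g ∧ ∀ c N x, Good M r c N x →
    g x = if P c then 1 / (N : ℚ) ^ D else 0

section cert
variable {ι : Type} {D n : ℕ} {M : ι} {r : (Fin D → ι) → Fin n}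

lemma Good.one {c : ι → ℕ} {N : ℕ} {x : Fin n → ℚ} (h : Good M r c N x) :
    x (r (padL D M [])) = 1 / (N : ℚ) ^ D := by
  rw [h.pad [] (by simp)]; simp

lemma Cert.not {P : (ι → ℕ) → Bool} (h : Cert M r P) : Cert M r (fun c => ! P c) := by
  obtain ⟨g, hg, h⟩ := h
  refine ⟨_, Sc.relu2 0 1 (-1) (Sc.var (r (padL D M []))) hg, fun c N x hx => ?_⟩
  have hp : 0 ≤ 1 / (N : ℚ) ^ D := by positivity
  simp only [hx.one, h c N x hx]
  by_cases hP : P c = true <;> simp [hP]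

lemma Cert.and {P Q : (ι → ℕ) → Bool} (h : Cert M r P) (h' : Cert M r Q) :
    Cert M r (fun c => P c && Q c) := by
  obtain ⟨g, hg, h⟩ := h
  obtain ⟨g', hg', h'⟩ := h'
  refine ⟨_, Sc.relu3 0 1 1 (-1) hg hg' (Sc.var (r (padL D M []))), fun c N x hx => ?_⟩
  have hp : 0 ≤ 1 / (N : ℚ) ^ D := by positivity
  simp only [hx.one, h c N x hx, h' c N x hx]
  by_cases hP : P c = true <;> by_cases hQ : Q c = true <;> simp [hP, hQ]

lemma Cert.ineq {m : ℕ} (χ : Fin m → ι) (t : PeanoIneq m) (ht : t.deg ≤ D) :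
    Cert M r (fun c => t.sat (fun i => c (χ i))) := by
  have h1 : Sc (n := n) (fun x => max 0 (0 + ∑ o : Option (Fin t.K),
      (o.elim (-(t.b : ℚ)) (fun i => (t.a i : ℚ))) *
        x (o.elim (r (padL D M [])) (fun i => r (padL D M ((t.mon i).map χ)))))) :=
    Sc.relu _ _ (fun o => Sc.var _)
  refine ⟨_, Sc.relu2 0 1 (-1) (Sc.var (r (padL D M []))) h1, fun c N x hx => ?_⟩
  have hN : (0 : ℚ) < N := by exact_mod_cast hx.1
  have hp : 0 < 1 / (N : ℚ) ^ D := by positivity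
  have h2 : ∀ i, x (r (padL D M ((t.mon i).map χ))) =
      (monValZ (fun i => c (χ i)) (t.mon i) : ℚ) * (1 / (N : ℚ) ^ D) := by
    intro i
    have hi : (t.mon i).length ≤ t.deg :=
      Finset.le_sup (f := fun i => (t.mon i).length) (Finset.mem_univ i)
    rw [hx.pad _ (by simpa using hi.trans ht)]
    have : ((monValZ (fun i => c (χ i)) (t.mon i) : ℤ) : ℚ) =
        (((t.mon i).map χ).map (fun i => (c i : ℚ))).prod := by
      unfold monValZ
      induction t.mon i with
      | nil => simp
      | cons a l ih => simp at ih ⊢; rw [ih]; exact Or.inl rfl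
    rw [this]; ring
  set z : ℤ := (∑ i, t.a i * monValZ (fun i => c (χ i)) (t.mon i)) - t.b with hz
  have h3 : (0 + ∑ o : Option (Fin t.K),
      (o.elim (-(t.b : ℚ)) (fun i => (t.a i : ℚ))) *
        x (o.elim (r (padL D M [])) (fun i => r (padL D M ((t.mon i).map χ)))))
      = (z : ℚ) * (1 / (N : ℚ) ^ D) := by
    rw [Fintype.sum_option]
    simp only [Option.elim, hx.one, h2, hz]
    push_cast
    rw [sub_mul, Finset.sum_mul]
    simp only [mul_assoc]
    ring
  simp only [h3, hx.one]
  have hs : t.sat (fun i => c (χ i)) = decide (z ≤ 0) := by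
    unfold PeanoIneq.sat
    congr 1
    rw [hz]; exact propext (by omega)
  change _ = if t.sat (fun i => c (χ i)) = true then _ else _
  rw [hs]
  by_cases h0 : z ≤ 0
  · have h0' : (z : ℚ) ≤ 0 := by exact_mod_cast h0
    rw [max_eq_left (mul_nonpos_of_nonpos_of_nonneg h0' hp.le)]
    simp only [h0, decide_true, if_true]
    rw [max_eq_right] <;> linarith
  · have h0' : (1 : ℚ) ≤ z := by exact_mod_cast (by omega : 1 ≤ z)
    have h4 : 1 / (N : ℚ) ^ D ≤ z * (1 / (N : ℚ) ^ D) := le_mul_of_one_le_left hp.le h0'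
    rw [max_eq_right (a := 0) (hp.le.trans h4)]
    simp only [h0, decide_false]
    rw [max_eq_left]
    · simp
    · linarith

lemma Cert.peano {m : ℕ} (χ : Fin m → ι) (ψ : PeanoFormula m) (hψ : ψ.deg ≤ D) :
    Cert M r (fun c => ψ.sat (fun i => c (χ i))) := by
  induction ψ with
  | ineq t => exact Cert.ineq χ t hψ
  | not ψ ih => exact (ih hψ).not
  | and ψ₁ ψ₂ ih₁ ih₂ =>
    simp only [PeanoFormula.deg, max_le_iff] at hψ
    exact (ih₁ hψ.1).and (ih₂ hψ.2)

end cert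

/-- Truth of a depth-one formula at the focus, in terms of the counts. -/
def PML.cev {k : ℕ} (p : Fin k) : PML k → (XP k → ℕ) → Bool
  | .prop i, c => decide (c (fun a => a (.inl p) && a (.inl i)) ≠ 0)
  | .not φ, c => ! φ.cev p c
  | .and φ₁ φ₂, c => φ₁.cev p c && φ₂.cev p c
  | .modal _ π ψ φs, c => ψ.sat (fun i => c (argP p (π i) (φs i)))

lemma PML.sat_eq_cev {k : ℕ} {G : Graph k} {v : Fin G.n} {p : Fin k} (hv : G.MarkedBy v p)
    (φ : PML k) (h : φ.md ≤ 1) : PML.sat G φ v = φ.cev p (G.cnt v) := by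
  induction φ with
  | prop i =>
    simp only [PML.sat, PML.cev, cnt_prop hv]
    cases G.L v i <;> simp
  | not φ ih => simp only [PML.sat, PML.cev, ih h]
  | and φ₁ φ₂ ih₁ ih₂ =>
    simp only [PML.md] at h
    simp only [PML.sat, PML.cev, ih₁ (by omega), ih₂ (by omega)]
  | modal m π ψ φs ih =>
    simp only [PML.sat, PML.cev]
    congr 1
    funext i
    refine card_arg hv _ _ ?_
    have : (φs i).md ≤ Finset.univ.sup (fun i => (φs i).md) :=
      Finset.le_sup (f := fun i => (φs i).md) (Finset.mem_univ i)
    simp only [PML.md] at h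
    omega

lemma PML.cert {k n D : ℕ} (p : Fin k) (r : (Fin D → XP k) → Fin n) (hD : 1 ≤ D)
    (φ : PML k) (h : φ.deg ≤ D) : Cert (markP p) r (φ.cev p) := by
  induction φ with
  | prop i =>
    have := (Cert.ineq (M := markP p) (r := r) (m := 1)
      (fun _ => (fun a => a (.inl p) && a (.inl i) : XP k))
      ⟨1, fun _ => 1, fun _ => [0], 0⟩ (by simpa [PeanoIneq.deg] using hD)).not
    convert this using 2 with c
    simp [PML.cev, PeanoIneq.sat, monValZ]
  | not φ ih => exact (ih h).not
  | and φ₁ φ₂ ih₁ ih₂ =>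
    simp only [PML.deg, max_le_iff] at h
    exact (ih₁ h.1).and (ih₂ h.2)
  | modal m π ψ φs ih =>
    simp only [PML.deg, max_le_iff] at h
    exact Cert.peano (fun i => argP p (π i) (φs i)) ψ h.1

/-! ### Aggregation -/

lemma foldr_max_nonneg (l : List ℚ) : 0 ≤ l.foldr Max.max 0 := by
  induction l with
  | nil => simp
  | cons a l ih => simp [ih]

lemma foldr_max_bool (l : List ℚ) (h : ∀ a ∈ l, a = 0 ∨ a = 1) :
    l.foldr Max.max 0 = if (1 : ℚ) ∈ l then 1 else 0 := by
  induction l with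
  | nil => simp
  | cons a l ih =>
    have := ih (fun b hb => h b (by simp [hb]))
    rw [List.foldr_cons, this]
    rcases h a (by simp) with rfl | rfl
    · simp; split_ifs <;> simp
    · simp; split_ifs <;> simp

lemma Agg.eval_nonneg {d : ℕ} (A : Agg) (s : Multiset (Fin d → ℚ)) (h : ∀ f ∈ s, ∀ i, 0 ≤ f i)
    (i : Fin d) : 0 ≤ A.eval s i := by
  have hs : 0 ≤ (s.map (fun f => f i)).sum := by
    apply Multiset.sum_nonneg
    intro x hx
    obtain ⟨f, hf, rfl⟩ := Multiset.mem_map.mp hx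
    exact h f hf i
  cases A
  · exact div_nonneg hs (by positivity)
  · exact hs
  · exact foldr_max_nonneg _

lemma Agg.eval_mark {d N : ℕ} (X : Agg) (hX : X = .sum ∨ X = .max) (S : Finset (Fin N))
    (x : Fin N → Fin d → ℚ) (i : Fin d) (v : Fin N) (hx : ∀ u, x u i = if u = v then 1 else 0) :
    X.eval (S.val.map x) i = if v ∈ S then 1 else 0 := by
  rcases hX with rfl | rfl
  · simp only [Agg.eval, Multiset.map_map, Function.comp_def, hx]
    change ∑ u ∈ S, _ = _
    simp
  · simp only [Agg.eval, Multiset.map_map, Function.comp_def, hx]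
    rw [foldr_max_bool]
    · congr 1
      simp
    · intro a ha
      simp at ha
      obtain ⟨u, -, rfl⟩ := ha
      split_ifs <;> simp

lemma Agg.eval_mean_univ {d N : ℕ} (x : Fin N → Fin d → ℚ) (i : Fin d) :
    Agg.mean.eval ((Finset.univ : Finset (Fin N)).val.map x) i = (∑ u, x u i) / N := by
  simp only [Agg.eval, Multiset.map_map, Function.comp_def, Multiset.card_map]
  simp [Finset.sum]

/-! ### Layers -/

def iSelf {d : ℕ} (i : Fin d) : Fin (d + d + d + d) := Fin.castAdd d (Fin.castAdd d (Fin.castAdd d i))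
def iIn {d : ℕ} (i : Fin d) : Fin (d + d + d + d) := Fin.castAdd d (Fin.castAdd d (Fin.natAdd d i))
def iOut {d : ℕ} (i : Fin d) : Fin (d + d + d + d) := Fin.castAdd d (Fin.natAdd (d + d) i)
def iGlob {d : ℕ} (i : Fin d) : Fin (d + d + d + d) := Fin.natAdd (d + d + d) i

/-- The input vector of the combination function. -/
noncomputable def MPNNLayer.inp {k din dout : ℕ} (l : MPNNLayer din dout) (G : Graph k)
    (x : Fin G.n → Fin din → ℚ) (v : Fin G.n) : Fin (din + din + din + din) → ℚ :=
  (Fin.append (Fin.append (Fin.append (x v)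
      (l.locIn.eval ((G.neighIn v).val.map x)))
      (l.locOut.eval ((G.neighOut v).val.map x)))
      (l.glob.eval ((Finset.univ : Finset (Fin G.n)).val.map x)))

section inp
variable {k din dout : ℕ} (l : MPNNLayer din dout) (G : Graph k)
    (x : Fin G.n → Fin din → ℚ) (v : Fin G.n) (i : Fin din)

lemma inp_self : l.inp G x v (iSelf i) = x v i := by simp [MPNNLayer.inp, iSelf]
lemma inp_in : l.inp G x v (iIn i) = l.locIn.eval ((G.neighIn v).val.map x) i := by
  simp only [MPNNLayer.inp, iIn, Fin.append_left, Fin.append_right]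
lemma inp_out : l.inp G x v (iOut i) = l.locOut.eval ((G.neighOut v).val.map x) i := by
  simp [MPNNLayer.inp, iOut]
lemma inp_glob : l.inp G x v (iGlob i) =
    l.glob.eval ((Finset.univ : Finset (Fin G.n)).val.map x) i := by
  simp [MPNNLayer.inp, iGlob]

lemma inp_nonneg (hx : ∀ u i, 0 ≤ x u i) (j : Fin (din + din + din + din)) :
    0 ≤ l.inp G x v j := by
  have hm : ∀ S : Finset (Fin G.n), ∀ f ∈ S.val.map x, ∀ i, 0 ≤ f i := by
    intro S f hf i
    obtain ⟨u, -, rfl⟩ := Multiset.mem_map.mp hf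
    exact hx u i
  unfold MPNNLayer.inp
  refine Fin.addCases (fun j => ?_) (fun j => ?_) j
  · refine Fin.addCases (fun j => ?_) (fun j => ?_) j
    · refine Fin.addCases (fun j => ?_) (fun j => ?_) j
      · simpa using hx v j
      · simp only [Fin.append_left, Fin.append_right]
        exact Agg.eval_nonneg _ _ (hm _) j
    · simp only [Fin.append_left, Fin.append_right]
      exact Agg.eval_nonneg _ _ (hm _) j
  · simp only [Fin.append_right]
    exact Agg.eval_nonneg _ _ (hm _) j

end inp

/-- Build a layer from scalar functions. -/
lemma exists_layer {din dout : ℕ} (A B C : Agg)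
    (g : Fin dout → (Fin (din + din + din + din) → ℚ) → ℚ) (hg : ∀ j, Sc (g j)) :
    ∃ l : MPNNLayer din dout, l.locIn = A ∧ l.locOut = B ∧ l.glob = C ∧
      ∀ (k : ℕ) (G : Graph k) (x : Fin G.n → Fin din → ℚ), (∀ u i, 0 ≤ x u i) →
        ∀ u j, l.step G x u j = g j (l.inp G x u) := by
  obtain ⟨N, hN⟩ := Sc.family g hg
  refine ⟨⟨N, A, B, C⟩, rfl, rfl, rfl, fun k G x hx u j => ?_⟩
  exact hN _ (inp_nonneg _ G x u hx) j

/-- Coordinates of the states: properties and monomials of degree `d + 1`. -/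
abbrev St (k d : ℕ) : Type := XP k ⊕ (Fin (d + 1) → XP k)

noncomputable abbrev stDim (k d : ℕ) : ℕ := Fintype.card (St k d)

noncomputable abbrev co {k d : ℕ} (t : St k d) : Fin (stDim k d) := Fintype.equivFin (St k d) t

/-- The intended state after `j + 1` layers. -/
noncomputable def ideal {k : ℕ} (d : ℕ) (G : Graph k) (v : Fin G.n) (j : ℕ) (u : Fin G.n) : St k d → ℚ
  | .inl χ => if χ (G.ext v u) then 1 else 0
  | .inr s => (∏ i ∈ Finset.range j, ((G.cnt v (s (Fin.ofNat (d + 1) i)) : ℚ) / G.n)) *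
      if s (Fin.ofNat (d + 1) j) (G.ext v u) then 1 else 0

lemma cnt_div_le {k : ℕ} (G : Graph k) (v : Fin G.n) (χ : XP k) : (G.cnt v χ : ℚ) / G.n ≤ 1 := by
  apply div_le_one_of_le₀ _ (by positivity)
  have : G.cnt v χ ≤ G.n := by
    simpa [Graph.cnt] using Finset.card_le_univ (Finset.univ.filter (fun u => χ (G.ext v u) = true))
  exact_mod_cast this

lemma ideal_nonneg {k : ℕ} (d : ℕ) (G : Graph k) (v : Fin G.n) (j : ℕ) (u : Fin G.n) (t : St k d) :
    0 ≤ ideal d G v j u t := by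
  cases t with
  | inl χ => simp only [ideal]; positivity
  | inr s => simp only [ideal]; positivity

lemma ideal_sum {k : ℕ} (d : ℕ) (G : Graph k) (v : Fin G.n) (j : ℕ) (s : Fin (d + 1) → XP k) :
    (∑ u, ideal d G v j u (.inr s)) / (G.n : ℚ) =
      ∏ i ∈ Finset.range (j + 1), ((G.cnt v (s (Fin.ofNat (d + 1) i)) : ℚ) / G.n) := by
  simp only [ideal]
  rw [← Finset.mul_sum, Finset.prod_range_succ, mul_div_assoc]
  congr 2
  simp [Graph.cnt]

lemma exists_first {k : ℕ} (d : ℕ) (p : Fin k) (X : Agg) (hX : X = .sum ∨ X = .max) :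
    ∃ l : MPNNLayer k (stDim k d), l.locIn = X ∧ l.locOut = X ∧ l.glob = .mean ∧
      ∀ (G : Graph k) (v : Fin G.n), G.MarkedBy v p → ∀ u t,
        l.step G (fun u => G.init k u) u (co t) = ideal d G v 0 u t := by
  let r : Fin k ⊕ Bool → Fin (k + k + k + k) := fun
    | .inl i => iSelf i
    | .inr false => iOut p
    | .inr true => iIn p
  have h := fun χ : XP k => Sc.bool r χ
  choose g hg1 hg2 using h
  let pr : St k d → XP k := fun
    | .inl χ => χ
    | .inr s => s (Fin.ofNat (d + 1) 0)
  obtain ⟨l, h1, h2, h3, h4⟩ := exists_layer (din := k) (dout := stDim k d) X X .mean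
    (fun j => g (pr ((Fintype.equivFin (St k d)).symm j))) (fun j => hg1 _)
  refine ⟨l, h1, h2, h3, fun G v hv u t => ?_⟩
  have hmark : ∀ u, G.init k u p = if u = v then (1 : ℚ) else 0 := by
    intro u
    simp [Graph.init, hv u]
  rw [h4 k G _ (fun u i => by unfold Graph.init; split_ifs <;> simp), Equiv.symm_apply_apply,
    hg2 _ _ (G.ext v u)]
  · cases t <;> simp [ideal, pr]
  · intro i
    match i with
    | .inl i =>
      simp only [r, inp_self, Graph.ext]
      by_cases h : G.L u i = true <;> simp [Graph.init, h]
    | .inr false =>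
      simp only [r, inp_out, h2, Graph.ext]
      rw [Agg.eval_mark X hX _ _ p v hmark]
      simp [Graph.neighOut]
    | .inr true =>
      simp only [r, inp_in, h1, Graph.ext]
      rw [Agg.eval_mark X hX _ _ p v hmark]
      simp [Graph.neighIn]

lemma exists_mul (k d j : ℕ) :
    ∃ l : MPNNLayer (stDim k d) (stDim k d), l.locIn = .mean ∧ l.locOut = .mean ∧ l.glob = .mean ∧
      ∀ (G : Graph k) (v : Fin G.n) (x : Fin G.n → Fin (stDim k d) → ℚ),
        (∀ u t, x u (co t) = ideal d G v j u t) → ∀ u t,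
        l.step G x u (co t) = ideal d G v (j + 1) u t := by
  let g : St k d → (Fin (stDim k d + stDim k d + stDim k d + stDim k d) → ℚ) → ℚ := fun
    | .inl χ => fun x => x (iSelf (co (.inl χ)))
    | .inr s => fun x => max 0 (-1 + 1 * x (iGlob (co (.inr s))) +
        1 * x (iSelf (co (.inl (s (Fin.ofNat (d + 1) (j + 1)))))))
  have hg : ∀ t, Sc (g t) := by
    rintro (χ | s)
    · exact Sc.var _
    · exact Sc.relu2 _ _ _ (Sc.var _) (Sc.var _)
  obtain ⟨l, h1, h2, h3, h4⟩ := exists_layer (din := stDim k d) (dout := stDim k d)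
    .mean .mean .mean (fun j => g ((Fintype.equivFin (St k d)).symm j)) (fun j => hg _)
  refine ⟨l, h1, h2, h3, fun G v x hx u t => ?_⟩
  have hx0 : ∀ u i, 0 ≤ x u i := by
    intro u i
    have := hx u ((Fintype.equivFin (St k d)).symm i)
    rw [co, Equiv.apply_symm_apply] at this
    rw [this]
    exact ideal_nonneg ..
  rw [h4 k G x hx0, Equiv.symm_apply_apply]
  cases t with
  | inl χ => simp only [g, inp_self, hx, ideal]
  | inr s =>
    simp only [g, inp_self, inp_glob, h3, Agg.eval_mean_univ, hx, ideal_sum]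
    have ha : 0 ≤ ∏ i ∈ Finset.range (j + 1), ((G.cnt v (s (Fin.ofNat (d + 1) i)) : ℚ) / G.n) :=
      Finset.prod_nonneg (fun i _ => by positivity)
    have hb : ∏ i ∈ Finset.range (j + 1), ((G.cnt v (s (Fin.ofNat (d + 1) i)) : ℚ) / G.n) ≤ 1 :=
      Finset.prod_le_one (fun i _ => by positivity) (fun i _ => cnt_div_le ..)
    simp only [ideal]
    split_ifs
    · rw [max_eq_right] <;> linarith
    · rw [max_eq_left] <;> linarith

lemma exists_final {k : ℕ} (d : ℕ) (p : Fin k) (φ : PML k) (hd : φ.deg ≤ d + 1) (hφ : φ.md ≤ 1) :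
    ∃ l : MPNNLayer (stDim k d) (stDim k d), l.locIn = .mean ∧ l.locOut = .mean ∧ l.glob = .mean ∧
      ∀ (G : Graph k) (v : Fin G.n) (x : Fin G.n → Fin (stDim k d) → ℚ), G.MarkedBy v p →
        (∀ u t, x u (co t) = ideal d G v d u t) → ∀ u j,
        l.step G x u j = if PML.sat G φ v then 1 / (G.n : ℚ) ^ (d + 1) else 0 := by
  obtain ⟨g, hg1, hg2⟩ := PML.cert (D := d + 1) p
    (fun s => iGlob (co (k := k) (d := d) (.inr s))) (by omega) φ hd
  obtain ⟨l, h1, h2, h3, h4⟩ := exists_layer (din := stDim k d) (dout := stDim k d)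
    .mean .mean .mean (fun _ => g) (fun _ => hg1)
  refine ⟨l, h1, h2, h3, fun G v x hv hx u j => ?_⟩
  have hx0 : ∀ u i, 0 ≤ x u i := by
    intro u i
    have := hx u ((Fintype.equivFin (St k d)).symm i)
    rw [co, Equiv.apply_symm_apply] at this
    rw [this]
    exact ideal_nonneg ..
  rw [h4 k G x hx0, hg2 (G.cnt v) G.n _ ⟨v.pos, cnt_mark hv, ?_⟩, PML.sat_eq_cev hv φ hφ]
  intro s
  simp only [inp_glob, h3, Agg.eval_mean_univ, hx, ideal_sum]
  rw [Finset.prod_range]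
  simp only [Fin.ofNat_eq_cast, Fin.cast_val_eq_self]
  rw [Finset.prod_div_distrib]
  simp

/-- for `A = {mean, sum}` or `A = {mean, max}` there is a
constant `C` such that every `φ ∈ PML₁` (arbitrary modalities) is recognised,
over pointed graphs whose focus is strongly marked by colour `p`, by an MPNN
from `M_A` with at most `C·(deg(φ)+1)` layers with certainty `1/|V|^e` for
some `e ≤ C·(deg(φ)+1)`. -/
theorem statement6 (A : Set Agg)
    (hA : A = {Agg.mean, Agg.sum} ∨ A = {Agg.mean, Agg.max}) :
    ∃ C : ℕ, ∀ (k : ℕ) (p : Fin k) (φ : PML k), φ.md ≤ 1 →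
      ∃ (M : MPNN) (e : ℕ), M.UsesAggs A ∧ M.dims 0 = k ∧
        M.L ≤ C * (φ.deg + 1) ∧ e ≤ C * (φ.deg + 1) ∧
        Recognises M φ (fun G v => G.StronglyMarkedBy v p)
          (fun n => 1 / (n : ℚ) ^ e) := by
  classical
  obtain ⟨X, hX, hXA, hmA⟩ : ∃ X : Agg, (X = .sum ∨ X = .max) ∧ X ∈ A ∧ Agg.mean ∈ A := by
    rcases hA with rfl | rfl
    · exact ⟨.sum, by simp⟩
    · exact ⟨.max, by simp⟩
  refine ⟨2, fun k p φ hφ => ?_⟩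
  obtain ⟨F, hF1, hF2, hF3, hF⟩ := exists_first φ.deg p X hX
  choose Q hQ1 hQ2 hQ3 hQ using fun j => exists_mul k φ.deg j
  obtain ⟨R, hR1, hR2, hR3, hR⟩ := exists_final φ.deg p φ (by omega) hφ
  let dims : ℕ → ℕ := fun i => Nat.casesOn i k (fun _ => stDim k φ.deg)
  let layers : (i : ℕ) → MPNNLayer (dims i) (dims (i + 1)) := fun i =>
    match i with
    | 0 => F
    | j + 1 => if j < φ.deg then Q j else R
  let M : MPNN := ⟨φ.deg + 2, dims, layers⟩
  refine ⟨M, φ.deg + 1, ?_, rfl, ?_, by omega, ?_⟩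
  · intro i _
    match i with
    | 0 => exact ⟨hF1 ▸ hXA, hF2 ▸ hXA, hF3 ▸ hmA⟩
    | j + 1 =>
      change (if j < φ.deg then Q j else R).locIn ∈ A ∧ (if j < φ.deg then Q j else R).locOut ∈ A ∧
        (if j < φ.deg then Q j else R).glob ∈ A
      split_ifs
      · rw [hQ1, hQ2, hQ3]; exact ⟨hmA, hmA, hmA⟩
      · rw [hR1, hR2, hR3]; exact ⟨hmA, hmA, hmA⟩
  · change φ.deg + 2 ≤ _
    omega
  · intro G v hv
    have hst : ∀ j ≤ φ.deg, ∀ u (t : St k φ.deg),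
        (M.state G (j + 1) u : Fin (stDim k φ.deg) → ℚ) (co t) = ideal φ.deg G v j u t := by
      intro j
      induction j with
      | zero => intro _ u t; exact hF G v hv.1 u t
      | succ j ih =>
        intro hj u t
        change (if j < φ.deg then Q j else R).step G (M.state G (j + 1)) u (co t) = _
        rw [if_pos (by omega)]
        exact hQ j G v _ (ih (by omega)) u t
    have hlast : ∀ i : Fin (stDim k φ.deg),
        (M.state G (φ.deg + 2) v : Fin (stDim k φ.deg) → ℚ) i =
          if PML.sat G φ v then 1 / (G.n : ℚ) ^ (φ.deg + 1) else 0 := by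
      intro i
      change (if φ.deg < φ.deg then Q φ.deg else R).step G (M.state G (φ.deg + 1)) v i = _
      rw [if_neg (lt_irrefl _)]
      exact hR G v _ hv.1 (hst φ.deg le_rfl) v i
    have hpos : 0 < stDim k φ.deg := Fintype.card_pos
    have hout : M.out G v = if PML.sat G φ v then 1 / (G.n : ℚ) ^ (φ.deg + 1) else 0 := by
      change lastVal (d := stDim k φ.deg) (M.state G (φ.deg + 2) v) = _
      unfold lastVal
      rw [dif_pos hpos]
      exact hlast _
    rw [hout]
    constructor
    · intro h; rw [if_pos h]
    · intro h; simp [h]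

end PMLMPNN
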